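/- Let k be a field of characteristic 2, let A and B be free unital associative k-algebras on generating types X and Y respectively, equipped with differentials ∂_A and ∂_B, and let Φ : A → B be a unital k-algebra homomorphism with Φ∘∂_A = ∂_B∘Φ (a DGA morphism). Let ε be an augmentation of (B, ∂_B). Then: (i) ε∘Φ is an augmentation of (A, ∂_A); (ii) the conjugated morphism Φ^ε := Ψ_ε∘Φ∘Ψ_{ε∘Φ}^{-1} has no constant term on generators, i.e. π₀∘Φ^ε vanishes on the span A₁ of the generators of A; and (iii) writing ∂_A^{ε∘Φ} := Ψ_{ε∘Φ}∘∂_A∘Ψ_{ε∘Φ}^{-1} and ∂_B^ε := Ψ_ε∘∂_B∘Ψ_ε^{-1}, the linearizations satisfy (Φ^ε)₁∘(∂_A^{ε∘Φ})₁ = (∂_B^ε)₁∘(Φ^ε)₁ as linear maps from A₁ to B₁, where for any such map F the linearization F₁ is π₁∘F restricted to the word-length-one part. -/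

import Mathlib

open scoped Classical

/-- The projection of the free algebra onto its word-length-`m` part `A_m`, defined via
the basis of the free algebra indexed by the free monoid (words) on the generators. -/
noncomputable def wordProj (k X : Type*) [Field k] (m : ℕ) :
    FreeAlgebra k X →ₗ[k] FreeAlgebra k X :=
  (FreeAlgebra.basisFreeMonoid k X).constr k fun w =>
    if FreeMonoid.length w = m then FreeAlgebra.basisFreeMonoid k X w else 0

/-- The span `A₁` of the generators of the free algebra. -/
def genSpan (k X : Type*) [Field k] : Submodule k (FreeAlgebra k X) :=
  Submodule.span k (Set.range (FreeAlgebra.ι k : X → FreeAlgebra k X))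

/-- A differential on the free algebra: square zero and the (sign-free, characteristic
two) Leibniz rule. -/
def IsDifferential {k X : Type*} [Field k]
    (d : FreeAlgebra k X →ₗ[k] FreeAlgebra k X) : Prop :=
  (∀ a, d (d a) = 0) ∧ ∀ u v : FreeAlgebra k X, d (u * v) = d u * v + u * d v

/-- An augmentation of a DGA `(A, ∂)`: a unital algebra map to `k` vanishing on `im ∂`. -/
def IsAugmentation {k X : Type*} [Field k]
    (d : FreeAlgebra k X →ₗ[k] FreeAlgebra k X) (ε : FreeAlgebra k X →ₐ[k] k) : Prop :=
  ∀ a, ε (d a) = 0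

/-- The algebra endomorphism `Ψ_ε` determined on generators by `x ↦ x − ε(x)·1`. -/
noncomputable def PsiAug {k X : Type*} [Field k] (ε : FreeAlgebra k X →ₐ[k] k) :
    FreeAlgebra k X →ₐ[k] FreeAlgebra k X :=
  FreeAlgebra.lift k fun x =>
    FreeAlgebra.ι k x - algebraMap k (FreeAlgebra k X) (ε (FreeAlgebra.ι k x))

/-- The inverse `Ψ_ε⁻¹`, determined on generators by `x ↦ x + ε(x)·1`. -/
noncomputable def PsiAugInv {k X : Type*} [Field k] (ε : FreeAlgebra k X →ₐ[k] k) :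
    FreeAlgebra k X →ₐ[k] FreeAlgebra k X :=
  FreeAlgebra.lift k fun x =>
    FreeAlgebra.ι k x + algebraMap k (FreeAlgebra k X) (ε (FreeAlgebra.ι k x))

/-- The conjugated differential `∂^ε = Ψ_ε ∘ ∂ ∘ Ψ_ε⁻¹`. -/
noncomputable def conjDiff {k X : Type*} [Field k]
    (d : FreeAlgebra k X →ₗ[k] FreeAlgebra k X) (ε : FreeAlgebra k X →ₐ[k] k) :
    FreeAlgebra k X →ₗ[k] FreeAlgebra k X :=
  (PsiAug ε).toLinearMap ∘ₗ d ∘ₗ (PsiAugInv ε).toLinearMap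

/-- The conjugated DGA morphism `Φ^ε = Ψ_ε ∘ Φ ∘ Ψ_{ε∘Φ}⁻¹`. -/
noncomputable def conjMorph {k X Y : Type*} [Field k]
    (Φ : FreeAlgebra k X →ₐ[k] FreeAlgebra k Y) (ε : FreeAlgebra k Y →ₐ[k] k) :
    FreeAlgebra k X →ₗ[k] FreeAlgebra k Y :=
  (PsiAug ε).toLinearMap ∘ₗ Φ.toLinearMap ∘ₗ (PsiAugInv (ε.comp Φ)).toLinearMap

namespace FreeAlgebra

variable {k X Y : Type*} [Field k]

theorem basisFreeMonoid_eq_lift (w : FreeMonoid X) :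
    basisFreeMonoid k X w = FreeMonoid.lift (ι k) w := by
  simp [basisFreeMonoid, equivMonoidAlgebraFreeMonoid]

theorem basisFreeMonoid_one : basisFreeMonoid k X 1 = 1 := by
  simp [basisFreeMonoid_eq_lift]

theorem basisFreeMonoid_of (x : X) : basisFreeMonoid k X (FreeMonoid.of x) = ι k x := by
  simp [basisFreeMonoid_eq_lift]

theorem basisFreeMonoid_mul (v w : FreeMonoid X) :
    basisFreeMonoid k X (v * w) = basisFreeMonoid k X v * basisFreeMonoid k X w := by
  simp [basisFreeMonoid_eq_lift]

theorem algebraMapInv_ι (x : X) : algebraMapInv (ι k x) = 0 := by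
  simp [algebraMapInv]

theorem algebraMapInv_basisFreeMonoid (w : FreeMonoid X) :
    algebraMapInv (basisFreeMonoid k X w) = if w.length = 0 then 1 else 0 := by
  induction w using FreeMonoid.inductionOn' with
  | one => simp [basisFreeMonoid_one]
  | of_mul x w => simp [basisFreeMonoid_mul, basisFreeMonoid_of, algebraMapInv_ι]

theorem wordProj_basisFreeMonoid (m : ℕ) (w : FreeMonoid X) :
    wordProj k X m (basisFreeMonoid k X w) =
      if w.length = m then basisFreeMonoid k X w else 0 := by
  rw [wordProj, Module.Basis.constr_basis]

theorem wordProj_ι (x : X) : wordProj k X 1 (ι k x) = ι k x := by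
  rw [← basisFreeMonoid_of, wordProj_basisFreeMonoid]
  simp

theorem wordProj_zero_eq (a : FreeAlgebra k X) :
    wordProj k X 0 a = algebraMap k _ (algebraMapInv a) := by
  suffices wordProj k X 0 =
      Algebra.linearMap k (FreeAlgebra k X) ∘ₗ algebraMapInv.toLinearMap from
    LinearMap.congr_fun this a
  refine (basisFreeMonoid k X).ext fun w => ?_
  rw [wordProj_basisFreeMonoid, LinearMap.comp_apply, AlgHom.toLinearMap_apply,
    algebraMapInv_basisFreeMonoid]
  split_ifs with h
  · rw [FreeMonoid.length_eq_zero.1 h, basisFreeMonoid_one]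
    simp
  · simp

/-- A linear map on the free algebra is a derivation at the origin when it satisfies the Leibniz
rule with respect to the augmentation killing all generators. -/
def IsDerivationAtOrigin {M : Type*} [AddCommGroup M] [Module k M]
    (G : FreeAlgebra k X →ₗ[k] M) : Prop :=
  ∀ u v, G (u * v) = algebraMapInv u • G v + algebraMapInv v • G u

theorem isDerivationAtOrigin_wordProj_one : IsDerivationAtOrigin (wordProj k X 1) := by
  intro u v
  let b := basisFreeMonoid k X
  let η : FreeAlgebra k X →ₗ[k] k := algebraMapInv.toLinearMap
  suffices (LinearMap.mul k (FreeAlgebra k X)).compr₂ (wordProj k X 1) =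
      (LinearMap.lsmul k (FreeAlgebra k X)).compl₁₂ η (wordProj k X 1) +
      ((LinearMap.lsmul k (FreeAlgebra k X)).compl₁₂ η (wordProj k X 1)).flip by
    simpa [η] using LinearMap.congr_fun₂ this u v
  refine b.ext fun v => b.ext fun w => ?_
  simp only [LinearMap.compr₂_apply, LinearMap.mul_apply', LinearMap.add_apply,
    LinearMap.compl₁₂_apply, LinearMap.flip_apply, LinearMap.lsmul_apply, η, b,
    AlgHom.toLinearMap_apply, algebraMapInv_basisFreeMonoid, ← basisFreeMonoid_mul,
    wordProj_basisFreeMonoid, FreeMonoid.length_mul]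
  rcases Nat.eq_zero_or_pos v.length with hv | hv <;>
    rcases Nat.eq_zero_or_pos w.length with hw | hw
  · simp [hv, hw]
  · simp [hw.ne', FreeMonoid.length_eq_zero.1 hv]
  · simp [hv.ne', FreeMonoid.length_eq_zero.1 hw]
  · rw [if_neg (by omega), if_neg hv.ne', if_neg hw.ne']
    simp

theorem IsDerivationAtOrigin.map_one {M : Type*} [AddCommGroup M] [Module k M]
    {G : FreeAlgebra k X →ₗ[k] M} (hG : IsDerivationAtOrigin G) : G 1 = 0 := by
  simpa using hG 1 1

/-- A derivation at the origin only depends on the linear part of its argument. -/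
theorem IsDerivationAtOrigin.map_wordProj_one {M : Type*} [AddCommGroup M] [Module k M]
    {G : FreeAlgebra k X →ₗ[k] M} (hG : IsDerivationAtOrigin G) (a : FreeAlgebra k X) :
    G (wordProj k X 1 a) = G a := by
  induction a using FreeAlgebra.induction with
  | grade0 r =>
    rw [Algebra.algebraMap_eq_smul_one]
    simp [hG.map_one, isDerivationAtOrigin_wordProj_one.map_one]
  | grade1 x => rw [wordProj_ι]
  | mul u v hu hv =>
    rw [isDerivationAtOrigin_wordProj_one, hG, map_add, map_smul, map_smul, hu, hv]
  | add u v hu hv => rw [map_add, map_add, map_add, hu, hv]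

theorem isDerivationAtOrigin_wordProj_one_comp_algHom (F : FreeAlgebra k X →ₐ[k] FreeAlgebra k Y)
    (hF : ∀ a, algebraMapInv (F a) = algebraMapInv a) :
    IsDerivationAtOrigin (wordProj k Y 1 ∘ₗ F.toLinearMap) := by
  intro u v
  simp only [LinearMap.comp_apply, AlgHom.toLinearMap_apply, map_mul]
  rw [isDerivationAtOrigin_wordProj_one, hF, hF]

theorem isDerivationAtOrigin_wordProj_one_comp_differential
    {d : FreeAlgebra k X →ₗ[k] FreeAlgebra k X} (hd : IsDifferential d)
    (h0 : ∀ a, algebraMapInv (d a) = 0) : IsDerivationAtOrigin (wordProj k X 1 ∘ₗ d) := by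
  intro u v
  simp only [LinearMap.comp_apply, hd.2, map_add]
  rw [isDerivationAtOrigin_wordProj_one, isDerivationAtOrigin_wordProj_one, h0, h0]
  simp [add_comm]

end FreeAlgebra

section PsiAug

open FreeAlgebra

variable {k X Y : Type*} [Field k]

theorem PsiAug_PsiAugInv (ε : FreeAlgebra k X →ₐ[k] k) (a : FreeAlgebra k X) :
    PsiAug ε (PsiAugInv ε a) = a := by
  suffices (PsiAug ε).comp (PsiAugInv ε) = AlgHom.id k _ from DFunLike.congr_fun this a
  ext x
  simp [PsiAug, PsiAugInv]

theorem PsiAugInv_PsiAug (ε : FreeAlgebra k X →ₐ[k] k) (a : FreeAlgebra k X) :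
    PsiAugInv ε (PsiAug ε a) = a := by
  suffices (PsiAugInv ε).comp (PsiAug ε) = AlgHom.id k _ from DFunLike.congr_fun this a
  ext x
  simp [PsiAug, PsiAugInv]

theorem algebraMapInv_PsiAug [CharP k 2] (ε : FreeAlgebra k X →ₐ[k] k) (a : FreeAlgebra k X) :
    algebraMapInv (PsiAug ε a) = ε a := by
  suffices algebraMapInv.comp (PsiAug ε) = ε from DFunLike.congr_fun this a
  ext x
  simp [PsiAug, algebraMapInv_ι, algebraMap_leftInverse _, CharTwo.neg_eq]

theorem isDifferential_conjDiff {d : FreeAlgebra k X →ₗ[k] FreeAlgebra k X}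
    (hd : IsDifferential d) (ε : FreeAlgebra k X →ₐ[k] k) : IsDifferential (conjDiff d ε) := by
  constructor
  · intro a
    simp [conjDiff, PsiAugInv_PsiAug, hd.1]
  · intro u v
    simp [conjDiff, hd.2, PsiAug_PsiAugInv]

theorem algebraMapInv_conjDiff [CharP k 2] {d : FreeAlgebra k X →ₗ[k] FreeAlgebra k X}
    {ε : FreeAlgebra k X →ₐ[k] k} (hε : IsAugmentation d ε) (a : FreeAlgebra k X) :
    algebraMapInv (conjDiff d ε a) = 0 := by
  simp [conjDiff, algebraMapInv_PsiAug, hε _]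

theorem algebraMapInv_conjMorph [CharP k 2] (Φ : FreeAlgebra k X →ₐ[k] FreeAlgebra k Y)
    (ε : FreeAlgebra k Y →ₐ[k] k) (a : FreeAlgebra k X) :
    algebraMapInv (conjMorph Φ ε a) = algebraMapInv a := by
  have h := algebraMapInv_PsiAug (ε.comp Φ) (PsiAugInv (ε.comp Φ) a)
  rw [PsiAug_PsiAugInv] at h
  simp [conjMorph, algebraMapInv_PsiAug, h]

theorem conjMorph_conjDiff {dA : FreeAlgebra k X →ₗ[k] FreeAlgebra k X}
    {dB : FreeAlgebra k Y →ₗ[k] FreeAlgebra k Y} {Φ : FreeAlgebra k X →ₐ[k] FreeAlgebra k Y}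
    (hΦ : ∀ a, Φ (dA a) = dB (Φ a)) (ε : FreeAlgebra k Y →ₐ[k] k) (a : FreeAlgebra k X) :
    conjMorph Φ ε (conjDiff dA (ε.comp Φ) a) = conjDiff dB ε (conjMorph Φ ε a) := by
  simp [conjMorph, conjDiff, PsiAugInv_PsiAug, hΦ]

end PsiAug

/-- for a DGA morphism `Φ : (A, ∂_A) → (B, ∂_B)` of free DGAs over a field
of characteristic 2 and an augmentation `ε` of `B`: (i) `ε∘Φ` is an augmentation of `A`;
(ii) the conjugated morphism `Φ^ε = Ψ_ε∘Φ∘Ψ_{ε∘Φ}⁻¹` has no constant term on the span of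
the generators; and (iii) the linearizations intertwine the linearized differentials:
`(Φ^ε)₁∘(∂_A^{ε∘Φ})₁ = (∂_B^ε)₁∘(Φ^ε)₁` on `A₁`. -/
theorem conjugated_morphism_linearizes {k X Y : Type*} [Field k] [CharP k 2]
    (dA : FreeAlgebra k X →ₗ[k] FreeAlgebra k X) (hdA : IsDifferential dA)
    (dB : FreeAlgebra k Y →ₗ[k] FreeAlgebra k Y) (hdB : IsDifferential dB)
    (Φ : FreeAlgebra k X →ₐ[k] FreeAlgebra k Y)
    (hΦ : ∀ a, Φ (dA a) = dB (Φ a))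
    (ε : FreeAlgebra k Y →ₐ[k] k) (hε : IsAugmentation dB ε) :
    IsAugmentation dA (ε.comp Φ) ∧
    (∀ a ∈ genSpan k X, wordProj k Y 0 (conjMorph Φ ε a) = 0) ∧
    ∀ a ∈ genSpan k X,
      wordProj k Y 1 (conjMorph Φ ε (wordProj k X 1 (conjDiff dA (ε.comp Φ) a))) =
        wordProj k Y 1 (conjDiff dB ε (wordProj k Y 1 (conjMorph Φ ε a))) := by
  refine ⟨fun a => ?_, fun a ha => ?_, fun a _ => ?_⟩
  · rw [AlgHom.comp_apply, hΦ, hε]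
  · have ha0 : genSpan k X ≤ LinearMap.ker FreeAlgebra.algebraMapInv.toLinearMap :=
      Submodule.span_le.2 (Set.range_subset_iff.2 FreeAlgebra.algebraMapInv_ι)
    rw [FreeAlgebra.wordProj_zero_eq, algebraMapInv_conjMorph,
      show FreeAlgebra.algebraMapInv a = 0 from ha0 ha, map_zero]
  · have hM := FreeAlgebra.isDerivationAtOrigin_wordProj_one_comp_algHom
      ((PsiAug ε).comp (Φ.comp (PsiAugInv (ε.comp Φ)))) (algebraMapInv_conjMorph Φ ε)
    have hD := FreeAlgebra.isDerivationAtOrigin_wordProj_one_comp_differential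
      (isDifferential_conjDiff hdB ε) (algebraMapInv_conjDiff hε)
    calc _ = wordProj k Y 1 (conjMorph Φ ε (conjDiff dA (ε.comp Φ) a)) := hM.map_wordProj_one _
      _ = wordProj k Y 1 (conjDiff dB ε (conjMorph Φ ε a)) := by rw [conjMorph_conjDiff hΦ]
      _ = _ := (hD.map_wordProj_one _).symm
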